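/- For every ψ ∈ C_c^∞(ℝ³;ℂ⁴): ∫_{ℝ³} |x| |(−iα·∇ψ)(x)|² dx = ∫_{ℝ³} |x| |∂_rψ(x) + ψ(x)/|x||² dx + ∫_{ℝ³} |ψ(x) + (2S·Lψ)(x)|² / |x| dx. -/

import Mathlib

open MeasureTheory Real Filter

noncomputable section

abbrev E3 := EuclideanSpace ℝ (Fin 3)
abbrev C4 := EuclideanSpace ℂ (Fin 4)

/-- Pauli matrices. -/
def pauli : Fin 3 → Matrix (Fin 2) (Fin 2) ℂ
  | 0 => !![0, 1; 1, 0]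
  | 1 => !![0, -Complex.I; Complex.I, 0]
  | 2 => !![1, 0; 0, -1]

/-- Dirac matrices αⱼ = [[0, σⱼ], [σⱼ, 0]]. -/
def diracAlpha (j : Fin 3) : Matrix (Fin 4) (Fin 4) ℂ :=
  Matrix.reindex finSumFinEquiv finSumFinEquiv
    (Matrix.fromBlocks 0 (pauli j) (pauli j) 0)

/-- Dirac matrix β = [[I₂, 0], [0, -I₂]]. -/
def diracBeta : Matrix (Fin 4) (Fin 4) ℂ :=
  Matrix.reindex finSumFinEquiv finSumFinEquiv
    (Matrix.fromBlocks (1 : Matrix (Fin 2) (Fin 2) ℂ) 0 0 (-1 : Matrix (Fin 2) (Fin 2) ℂ))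

/-- Block-diagonal matrix diag(σⱼ, σⱼ) (twice the spin angular momentum matrices). -/
def spinMat (j : Fin 3) : Matrix (Fin 4) (Fin 4) ℂ :=
  Matrix.reindex finSumFinEquiv finSumFinEquiv
    (Matrix.fromBlocks (pauli j) 0 0 (pauli j))

/-- Action of a 4 × 4 matrix on ℂ⁴ with the Euclidean norm. -/
def mulVecE (M : Matrix (Fin 4) (Fin 4) ℂ) (v : C4) : C4 :=
  Matrix.toEuclideanLin M v

/-- The partial derivative ∂ⱼψ(x). -/
def pderiv3 (j : Fin 3) (ψ : E3 → C4) (x : E3) : C4 :=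
  fderiv ℝ ψ x (EuclideanSpace.single j 1)

/-- The free Dirac operator (-iα·∇ψ)(x). -/
def diracD (ψ : E3 → C4) (x : E3) : C4 :=
  (-Complex.I) • ∑ j : Fin 3, mulVecE (diracAlpha j) (pderiv3 j ψ x)

/-- The radial derivative ∂_rψ(x) = Σⱼ (xⱼ/|x|) ∂ⱼψ(x). -/
def radialDeriv (ψ : E3 → C4) (x : E3) : C4 :=
  ∑ j : Fin 3, (x j / ‖x‖) • pderiv3 j ψ x

/-- The orbital angular momentum (Lⱼψ)(x) = -i (x × ∇)ⱼ ψ(x). -/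
def angMom (j : Fin 3) (ψ : E3 → C4) (x : E3) : C4 :=
  (-Complex.I) • ((x (j + 1)) • pderiv3 (j + 2) ψ x - (x (j + 2)) • pderiv3 (j + 1) ψ x)

/-- The spin-orbit term (2S·Lψ)(x) = Σⱼ diag(σⱼ,σⱼ) (Lⱼψ)(x). -/
def twoSL (ψ : E3 → C4) (x : E3) : C4 :=
  ∑ j : Fin 3, mulVecE (spinMat j) (angMom j ψ x)

theorem diracAlpha_zero : diracAlpha 0 =
    !![0, 0, 0, 1; 0, 0, 1, 0; 0, 1, 0, 0; 1, 0, 0, 0] := by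
  ext i j; fin_cases i <;> fin_cases j <;> rfl

theorem diracAlpha_one : diracAlpha 1 =
    !![0, 0, 0, -Complex.I; 0, 0, Complex.I, 0; 0, -Complex.I, 0, 0; Complex.I, 0, 0, 0] := by
  ext i j; fin_cases i <;> fin_cases j <;> rfl

theorem diracAlpha_two : diracAlpha 2 =
    !![0, 0, 1, 0; 0, 0, 0, -1; 1, 0, 0, 0; 0, -1, 0, 0] := by
  ext i j; fin_cases i <;> fin_cases j <;> rfl

theorem spinMat_zero : spinMat 0 =
    !![0, 1, 0, 0; 1, 0, 0, 0; 0, 0, 0, 1; 0, 0, 1, 0] := by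
  ext i j; fin_cases i <;> fin_cases j <;> rfl

theorem spinMat_one : spinMat 1 =
    !![0, -Complex.I, 0, 0; Complex.I, 0, 0, 0; 0, 0, 0, -Complex.I; 0, 0, Complex.I, 0] := by
  ext i j; fin_cases i <;> fin_cases j <;> rfl

theorem spinMat_two : spinMat 2 =
    !![1, 0, 0, 0; 0, -1, 0, 0; 0, 0, 1, 0; 0, 0, 0, -1] := by
  ext i j; fin_cases i <;> fin_cases j <;> rfl

theorem mulVecE_apply (M : Matrix (Fin 4) (Fin 4) ℂ) (v : C4) (i : Fin 4) :
    mulVecE M v i = M i 0 * v 0 + M i 1 * v 1 + M i 2 * v 2 + M i 3 * v 3 := by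
  simp [mulVecE, Matrix.mulVec, dotProduct, Fin.sum_univ_four]

/-- The operator `-i diag(σⱼ, σⱼ)`, as a real-linear map. -/
def spinGen (j : Fin 3) : C4 →L[ℝ] C4 :=
  (LinearMap.toContinuousLinearMap
    ((-Complex.I) • Matrix.toEuclideanLin (spinMat j))).restrictScalars ℝ

theorem spinGen_apply (j : Fin 3) (v : C4) :
    spinGen j v = (-Complex.I) • mulVecE (spinMat j) v := rfl

theorem mulVecE_smul (M : Matrix (Fin 4) (Fin 4) ℂ) (c : ℂ) (v : C4) :
    mulVecE M (c • v) = c • mulVecE M v := map_smul _ c v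

theorem inner_spinGen (j : Fin 3) (u v : C4) :
    inner ℝ u (spinGen j v) = -inner ℝ (spinGen j u) v := by
  simp only [PiLp.inner_apply, Fin.sum_univ_four, spinGen_apply, PiLp.smul_apply, mulVecE_apply]
  fin_cases j <;>
    simp [spinMat_zero, spinMat_one, spinMat_two, Complex.inner] <;> ring

theorem norm_sq_diracAlpha_sum (x : E3) (v : C4) :
    ‖∑ j, (x j) • mulVecE (diracAlpha j) v‖ ^ 2 = ‖x‖ ^ 2 * ‖v‖ ^ 2 := by
  simp only [EuclideanSpace.norm_sq_eq, Fin.sum_univ_four, Fin.sum_univ_three, PiLp.add_apply,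
    PiLp.smul_apply, mulVecE_apply, diracAlpha_zero, diracAlpha_one, diracAlpha_two,
    Complex.sq_norm, Complex.normSq_apply, Real.norm_eq_abs, sq_abs]
  simp
  ring

theorem diracAlpha_sum_mul (x : E3) (p : Fin 3 → C4) :
    ∑ j, (x j) • mulVecE (diracAlpha j) (∑ k, mulVecE (diracAlpha k) (p k)) =
      (∑ j, (x j) • p j) - ∑ j, spinGen j (x (j + 1) • p (j + 2) - x (j + 2) • p (j + 1)) := by
  have h1 : (1 : Fin 3) + 1 = 2 := rfl
  have h2 : (1 : Fin 3) + 2 = 0 := rfl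
  have h3 : (2 : Fin 3) + 1 = 0 := rfl
  have h4 : (2 : Fin 3) + 2 = 1 := rfl
  ext i
  simp only [Fin.sum_univ_three, PiLp.add_apply, PiLp.sub_apply, spinGen_apply,
    PiLp.smul_apply, mulVecE_apply, diracAlpha_zero, diracAlpha_one, diracAlpha_two,
    spinMat_zero, spinMat_one, spinMat_two, zero_add, h1, h2, h3, h4, Complex.real_smul,
    smul_eq_mul]
  fin_cases i <;> simp <;> ring_nf <;> simp [Complex.I_sq] <;> ring

/-- The vector field generating the rotations about the `j`-th coordinate axis. -/
def rotField (j : Fin 3) : E3 →L[ℝ] E3 :=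
  (EuclideanSpace.proj (j + 1)).smulRight (EuclideanSpace.single (j + 2) 1) -
    (EuclideanSpace.proj (j + 2)).smulRight (EuclideanSpace.single (j + 1) 1)

theorem rotField_apply (j : Fin 3) (x : E3) :
    rotField j x = x (j + 1) • EuclideanSpace.single (j + 2) 1 -
      x (j + 2) • EuclideanSpace.single (j + 1) 1 := rfl

theorem inner_rotField (j : Fin 3) (x : E3) : inner ℝ x (rotField j x) = 0 := by
  simp only [rotField_apply, inner_sub_right, inner_smul_right,
    EuclideanSpace.inner_single_right]
  simp
  ring

theorem euclidean_eq_sum_single (x : E3) : x = ∑ a, x a • EuclideanSpace.single a (1 : ℝ) := by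
  ext i
  fin_cases i <;> simp [Fin.sum_univ_three]

theorem integral_coord_mul_fderiv {f : E3 → ℝ} (hf : ContDiff ℝ 1 f) (hc : HasCompactSupport f)
    (a b : Fin 3) :
    ∫ x : E3, x a * fderiv ℝ f x (EuclideanSpace.single b 1) =
      -((if a = b then 1 else 0) * ∫ x, f x) := by
  have hd : ∀ x : E3, fderiv ℝ (fun y : E3 => y a) x = EuclideanSpace.proj a := fun x =>
    (EuclideanSpace.proj (𝕜 := ℝ) a).fderiv
  have hcoord : Continuous fun x : E3 => x a := (EuclideanSpace.proj (𝕜 := ℝ) a).continuous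
  have hf' : Continuous fun x => fderiv ℝ f x (EuclideanSpace.single b 1) :=
    (hf.continuous_fderiv one_ne_zero).clm_apply continuous_const
  have hc' : HasCompactSupport fun x => fderiv ℝ f x (EuclideanSpace.single b 1) :=
    hc.fderiv_apply ℝ _
  rw [integral_mul_fderiv_eq_neg_fderiv_mul_of_integrable]
  · simp only [hd, ← integral_const_mul]
    simp
  · simp only [hd]
    exact (continuous_const.mul hf.continuous).integrable_of_hasCompactSupport hc.mul_left
  · exact (hcoord.mul hf').integrable_of_hasCompactSupport hc'.mul_left
  · exact (hcoord.mul hf.continuous).integrable_of_hasCompactSupport hc.mul_left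
  · exact fun x _ => (EuclideanSpace.proj (𝕜 := ℝ) a).differentiableAt
  · exact fun x _ => hf.differentiable one_ne_zero x

theorem integrable_coord_mul_fderiv {f : E3 → ℝ} (hf : ContDiff ℝ 1 f) (hc : HasCompactSupport f)
    (a b : Fin 3) :
    Integrable fun x : E3 => x a * fderiv ℝ f x (EuclideanSpace.single b 1) :=
  ((EuclideanSpace.proj (𝕜 := ℝ) a).continuous.mul
    ((hf.continuous_fderiv one_ne_zero).clm_apply
      continuous_const)).integrable_of_hasCompactSupport (hc.fderiv_apply ℝ _).mul_left

theorem integral_fderiv_rotField {f : E3 → ℝ} (hf : ContDiff ℝ 1 f) (hc : HasCompactSupport f)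
    (j : Fin 3) : ∫ x, fderiv ℝ f x (rotField j x) = 0 := by
  simp only [rotField_apply, map_sub, map_smul, smul_eq_mul]
  rw [integral_sub (integrable_coord_mul_fderiv hf hc _ _)
    (integrable_coord_mul_fderiv hf hc _ _), integral_coord_mul_fderiv hf hc,
    integral_coord_mul_fderiv hf hc]
  fin_cases j <;> simp

theorem integral_fderiv_self {f : E3 → ℝ} (hf : ContDiff ℝ 1 f) (hc : HasCompactSupport f) :
    ∫ x, fderiv ℝ f x x = -3 * ∫ x, f x := by
  have h (x : E3) : fderiv ℝ f x x =
      ∑ a, x a * fderiv ℝ f x (EuclideanSpace.single a 1) := by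
    simpa using congrArg (fderiv ℝ f x) (euclidean_eq_sum_single x)
  simp only [h]
  rw [integral_finsetSum _ fun a _ => integrable_coord_mul_fderiv hf hc a a]
  simp only [integral_coord_mul_fderiv hf hc, Fin.sum_univ_three]
  simp
  ring

theorem integrable_inv_norm_mul {h : E3 → ℝ} (hh : Continuous h) (hc : HasCompactSupport h) :
    Integrable fun x : E3 => ‖x‖⁻¹ * h x := by
  obtain ⟨r, hr⟩ := hc.isCompact.isBounded.subset_ball (0 : E3)
  obtain ⟨C, hC⟩ := hh.bounded_above_of_compact_support hc
  have h1 : IntegrableOn (fun x : E3 => ‖x‖⁻¹) (Metric.ball 0 r) := by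
    rw [integrableOn_fun_norm_addHaar volume (f := fun y : ℝ => y⁻¹)]
    have : IntegrableOn (fun y : ℝ => y) (Set.Ioo 0 r) :=
      (continuous_id.integrableOn_Icc).mono_set Set.Ioo_subset_Icc_self
    refine this.congr_fun (fun y hy => ?_) measurableSet_Ioo
    have : y ≠ 0 := hy.1.ne'
    simp
    field_simp
  have h2 : IntegrableOn (fun x : E3 => ‖x‖⁻¹ * h x) (Metric.ball 0 r) :=
    Integrable.mul_bdd h1 hh.aestronglyMeasurable (Eventually.of_forall hC)
  refine (integrableOn_iff_integrable_of_support_subset fun x hx => hr ?_).1 h2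
  exact subset_tsupport _ (right_ne_zero_of_mul hx)

/-- A smooth approximation of `‖x‖⁻¹`. -/
def regInv (δ : ℝ) (x : E3) : ℝ := (‖x‖ ^ 2 + δ) ^ (-(1 / 2) : ℝ)

theorem contDiff_regInv {δ : ℝ} (hδ : 0 < δ) : ContDiff ℝ 1 (regInv δ) := by
  unfold regInv
  refine ContDiff.rpow_const_of_ne ((contDiff_norm_sq ℝ).add contDiff_const) fun x => ?_
  positivity

theorem fderiv_regInv {δ : ℝ} (hδ : 0 < δ) (x v : E3) :
    fderiv ℝ (regInv δ) x v = -(inner ℝ x v * (‖x‖ ^ 2 + δ) ^ (-(3 / 2) : ℝ)) := by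
  have h := ((hasStrictFDerivAt_norm_sq x).hasFDerivAt.add_const δ).rpow_const
    (p := (-(1 / 2) : ℝ)) (Or.inl (by positivity))
  have h' : fderiv ℝ (regInv δ) x = _ := h.fderiv
  rw [h']
  simp
  norm_num
  ring

theorem regInv_nonneg {δ : ℝ} (hδ : 0 ≤ δ) (x : E3) : 0 ≤ regInv δ x := by
  unfold regInv; positivity

theorem regInv_le {δ : ℝ} (hδ : 0 ≤ δ) {x : E3} (hx : x ≠ 0) : regInv δ x ≤ ‖x‖⁻¹ := by
  have hx' : 0 < ‖x‖ := norm_pos_iff.2 hx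
  calc regInv δ x ≤ (‖x‖ ^ 2) ^ (-(1 / 2) : ℝ) :=
        Real.rpow_le_rpow_of_nonpos (by positivity) (by linarith) (by norm_num)
    _ = ‖x‖⁻¹ := by
        rw [← Real.rpow_natCast, ← Real.rpow_mul hx'.le]
        norm_num [Real.rpow_neg_one]

theorem tendsto_regInv {x : E3} (hx : x ≠ 0) :
    Tendsto (fun δ => regInv δ x) (nhdsWithin 0 (Set.Ioi 0)) (nhds ‖x‖⁻¹) := by
  have hx' : 0 < ‖x‖ := norm_pos_iff.2 hx
  have h0 : regInv 0 x = ‖x‖⁻¹ := by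
    rw [regInv, add_zero, ← Real.rpow_natCast, ← Real.rpow_mul hx'.le]
    norm_num [Real.rpow_neg_one]
  rw [← h0]
  have : ContinuousAt (fun δ => regInv δ x) 0 :=
    (continuousAt_const.add continuousAt_id).rpow_const (Or.inl (by simp [hx]))
  exact this.tendsto.mono_left nhdsWithin_le_nhds

theorem regInv_add_fderiv {δ : ℝ} (hδ : 0 < δ) (x : E3) :
    regInv δ x + fderiv ℝ (regInv δ) x x = δ * (‖x‖ ^ 2 + δ)⁻¹ * regInv δ x := by
  have hp : 0 < ‖x‖ ^ 2 + δ := by positivity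
  rw [fderiv_regInv hδ, real_inner_self_eq_norm_sq,
    show (-(3 / 2) : ℝ) = -1 + -(1 / 2) by norm_num, Real.rpow_add hp, Real.rpow_neg_one, regInv]
  field_simp
  ring

/-- The spin-orbit term, written through the derivative along the rotation fields. -/
def spinOrbit (ψ : E3 → C4) (x : E3) : C4 :=
  ∑ j, spinGen j (fderiv ℝ ψ x (rotField j x))

section Regularity

variable {ψ : E3 → C4}

theorem contDiff_fderiv_apply_clm (hψ : ContDiff ℝ 2 ψ) (A : E3 →L[ℝ] E3) :
    ContDiff ℝ 1 fun x => fderiv ℝ ψ x (A x) :=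
  (hψ.fderiv_right (m := 1) (by norm_num)).clm_apply A.contDiff

theorem contDiff_euler (hψ : ContDiff ℝ 2 ψ) : ContDiff ℝ 1 fun x => fderiv ℝ ψ x x :=
  contDiff_fderiv_apply_clm hψ (ContinuousLinearMap.id ℝ E3)

theorem contDiff_spinOrbit (hψ : ContDiff ℝ 2 ψ) : ContDiff ℝ 1 (spinOrbit ψ) :=
  ContDiff.sum fun j _ => (spinGen j).contDiff.comp (contDiff_fderiv_apply_clm hψ (rotField j))

theorem fderiv_fderiv_apply_clm (hψ : ContDiff ℝ 2 ψ) (A : E3 →L[ℝ] E3) (x v : E3) :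
    fderiv ℝ (fun x => fderiv ℝ ψ x (A x)) x v =
      fderiv ℝ (fderiv ℝ ψ) x v (A x) + fderiv ℝ ψ x (A v) := by
  have h := (((hψ.fderiv_right (m := 1) (by norm_num)).differentiable
    one_ne_zero x).hasFDerivAt.clm_apply (A.hasFDerivAt (x := x))).fderiv
  rw [h]
  simp [add_comm]

theorem fderiv_spinOrbit_self (hψ : ContDiff ℝ 2 ψ) (x : E3) :
    fderiv ℝ (spinOrbit ψ) x x =
      ∑ j, spinGen j (fderiv ℝ (fun y => fderiv ℝ ψ y y) x (rotField j x)) := by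
  have h : HasFDerivAt (spinOrbit ψ) (∑ j, (spinGen j).comp
      (fderiv ℝ (fun y => fderiv ℝ ψ y (rotField j y)) x)) x :=
    HasFDerivAt.fun_sum fun j _ => (spinGen j).hasFDerivAt.comp x
      ((contDiff_fderiv_apply_clm hψ (rotField j)).differentiable one_ne_zero x).hasFDerivAt
  have hsymm : IsSymmSndFDerivAt ℝ ψ x := hψ.contDiffAt.isSymmSndFDerivAt (by simp)
  rw [h.fderiv]
  simp only [sum_apply, ContinuousLinearMap.comp_apply,
    fderiv_fderiv_apply_clm hψ]
  refine Finset.sum_congr rfl fun j _ => ?_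
  have h2 := fderiv_fderiv_apply_clm hψ (ContinuousLinearMap.id ℝ E3) x (rotField j x)
  simp only [ContinuousLinearMap.id_apply] at h2
  rw [h2, hsymm.eq]

/-- The pairing of the radial and the angular part of the Dirac operator is a combination of
derivatives along the Euler field and the rotation fields. -/
theorem two_mul_inner_euler_add (hψ : ContDiff ℝ 2 ψ) (x : E3) :
    2 * inner ℝ (fderiv ℝ ψ x x + ψ x) (ψ x + spinOrbit ψ x) =
      fderiv ℝ (fun y => inner ℝ (ψ y) (ψ y + spinOrbit ψ y)) x x +
        2 * inner ℝ (ψ x) (ψ x + spinOrbit ψ x) -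
        ∑ j, fderiv ℝ (fun y => inner ℝ (ψ y) (spinGen j (fderiv ℝ ψ y y))) x (rotField j x) := by
  have hd : DifferentiableAt ℝ ψ x := hψ.differentiable two_ne_zero x
  have hT : DifferentiableAt ℝ (spinOrbit ψ) x :=
    (contDiff_spinOrbit hψ).differentiable one_ne_zero x
  have hE : DifferentiableAt ℝ (fun y => fderiv ℝ ψ y y) x :=
    (contDiff_euler hψ).differentiable one_ne_zero x
  have hg (j : Fin 3) : fderiv ℝ (fun y => inner ℝ (ψ y) (spinGen j (fderiv ℝ ψ y y))) x
      (rotField j x) = inner ℝ (ψ x)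
        (spinGen j (fderiv ℝ (fun y => fderiv ℝ ψ y y) x (rotField j x))) -
        inner ℝ (spinGen j (fderiv ℝ ψ x (rotField j x))) (fderiv ℝ ψ x x) := by
    have h1 : HasFDerivAt (fun y => spinGen j (fderiv ℝ ψ y y))
        ((spinGen j).comp (fderiv ℝ (fun y => fderiv ℝ ψ y y) x)) x :=
      (spinGen j).hasFDerivAt.comp x hE.hasFDerivAt
    rw [fderiv_inner_apply ℝ hd h1.differentiableAt, h1.fderiv, inner_spinGen j (fderiv ℝ ψ x _)]
    simp [sub_eq_add_neg]
  have hT' : inner ℝ (spinOrbit ψ x) (fderiv ℝ ψ x x) =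
      ∑ j, inner ℝ (spinGen j (fderiv ℝ ψ x (rotField j x))) (fderiv ℝ ψ x x) :=
    sum_inner _ _ _
  simp only [hg]
  rw [fderiv_inner_apply ℝ hd (hd.fun_add hT), fderiv_fun_add hd hT, Finset.sum_sub_distrib, ← hT',
    ← inner_sum, ← fderiv_spinOrbit_self hψ]
  simp only [add_apply, inner_add_left, inner_add_right,
    real_inner_comm (fderiv ℝ ψ x x)]
  ring

end Regularity

theorem integral_mul_inner_euler_add {ψ : E3 → C4} (hψ : ContDiff ℝ 2 ψ)
    (hc : HasCompactSupport ψ) {w : E3 → ℝ} (hw : ContDiff ℝ 1 w)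
    (hrot : ∀ j x, fderiv ℝ w x (rotField j x) = 0) :
    2 * ∫ x, w x * inner ℝ (fderiv ℝ ψ x x + ψ x) (ψ x + spinOrbit ψ x) =
      -∫ x, (w x + fderiv ℝ w x x) * inner ℝ (ψ x) (ψ x + spinOrbit ψ x) := by
  set Q : E3 → ℝ := fun y => inner ℝ (ψ y) (ψ y + spinOrbit ψ y) with hQ_def
  set g : Fin 3 → E3 → ℝ := fun j y => inner ℝ (ψ y) (spinGen j (fderiv ℝ ψ y y)) with hg_def
  have hψ1 : ContDiff ℝ 1 ψ := hψ.of_le one_le_two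
  have hQ : ContDiff ℝ 1 Q := hψ1.inner ℝ (hψ1.add (contDiff_spinOrbit hψ))
  have hg (j) : ContDiff ℝ 1 (g j) :=
    hψ1.inner ℝ ((spinGen j).contDiff.comp (contDiff_euler hψ))
  have hcQ : HasCompactSupport Q := hc.mono fun x hx h => hx (by simp [hQ_def, h])
  have hcg (j) : HasCompactSupport (g j) := hc.mono fun x hx h => hx (by simp [hg_def, h])
  have hprod {f : E3 → ℝ} (hf : ContDiff ℝ 1 f) (x v : E3) :
      fderiv ℝ (fun y => w y * f y) x v = w x * fderiv ℝ f x v + f x * fderiv ℝ w x v := by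
    rw [fderiv_fun_mul (hw.differentiable one_ne_zero x) (hf.differentiable one_ne_zero x)]
    simp
  have hI {f : E3 → ℝ} (hf : ContDiff ℝ 1 f) (hcf : HasCompactSupport f) {A : E3 → E3}
      (hA : Continuous A) : Integrable fun x => fderiv ℝ f x (A x) := by
    refine ((hf.continuous_fderiv one_ne_zero).clm_apply hA).integrable_of_hasCompactSupport
      ((hcf.fderiv ℝ).mono fun x hx h => hx ?_)
    simp [h]
  have hwQ : ContDiff ℝ 1 fun x => w x * Q x := hw.mul hQ
  have hcwQ : HasCompactSupport fun x => w x * Q x := hcQ.mul_left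
  have hwg (j) : ContDiff ℝ 1 fun x => w x * g j x := hw.mul (hg j)
  have hcwg (j) : HasCompactSupport fun x => w x * g j x := (hcg j).mul_left
  have hIQ : Integrable fun x => w x * Q x := hwQ.continuous.integrable_of_hasCompactSupport hcwQ
  have hIw : Integrable fun x => (w x + fderiv ℝ w x x) * Q x :=
    ((hw.continuous.add ((hw.continuous_fderiv one_ne_zero).clm_apply continuous_id)).mul
      hQ.continuous).integrable_of_hasCompactSupport hcQ.mul_left
  have hpt (x : E3) : 2 * (w x * inner ℝ (fderiv ℝ ψ x x + ψ x) (ψ x + spinOrbit ψ x)) =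
      fderiv ℝ (fun y => w y * Q y) x x + 3 * (w x * Q x) - (w x + fderiv ℝ w x x) * Q x -
        ∑ j, fderiv ℝ (fun y => w y * g j y) x (rotField j x) := by
    simp only [hprod hQ, hprod (hg _), hrot, mul_zero, add_zero, ← Finset.mul_sum]
    linear_combination w x * two_mul_inner_euler_add hψ x
  rw [← integral_const_mul]
  simp only [hpt]
  rw [integral_sub, integral_sub, integral_add, integral_finsetSum, integral_fderiv_self hwQ hcwQ,
    integral_const_mul, Finset.sum_eq_zero fun j _ => integral_fderiv_rotField (hwg j) (hcwg j) j]
  · ring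
  · exact fun j _ => hI (hwg j) (hcwg j) (rotField j).continuous
  · exact hI hwQ hcwQ continuous_id
  · exact hIQ.const_mul 3
  · exact (hI hwQ hcwQ continuous_id).add (hIQ.const_mul 3)
  · exact hIw
  · exact ((hI hwQ hcwQ continuous_id).add (hIQ.const_mul 3)).sub hIw
  · exact integrable_finsetSum _ fun j _ => hI (hwg j) (hcwg j) (rotField j).continuous

theorem tendsto_integral_mul_of_regInv {h : E3 → ℝ} (hh : Continuous h)
    (hc : HasCompactSupport h) {w : ℝ → E3 → ℝ} {l : E3 → ℝ}
    (hw : ∀ δ > 0, Continuous (w δ)) (hle : ∀ δ > 0, ∀ x, |w δ x| ≤ regInv δ x)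
    (hlim : ∀ x ≠ 0, Tendsto (fun δ => w δ x) (nhdsWithin 0 (Set.Ioi 0)) (nhds (l x))) :
    Tendsto (fun δ => ∫ x, w δ x * h x) (nhdsWithin 0 (Set.Ioi 0)) (nhds (∫ x, l x * h x)) := by
  have hne : ∀ᵐ x : E3, x ≠ 0 := by simp [ae_iff]
  refine tendsto_integral_filter_of_dominated_convergence (fun x => ‖x‖⁻¹ * |h x|) ?_ ?_
    (integrable_inv_norm_mul hh.abs hc.abs) ?_
  · filter_upwards [self_mem_nhdsWithin] with δ hδ
    exact ((hw δ hδ).mul hh).aestronglyMeasurable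
  · filter_upwards [self_mem_nhdsWithin] with δ hδ
    filter_upwards [hne] with x hx
    rw [Real.norm_eq_abs, abs_mul]
    gcongr
    exact (hle δ hδ x).trans (regInv_le (le_of_lt hδ) hx)
  · filter_upwards [hne] with x hx
    exact (hlim x hx).mul_const _

theorem integral_inv_norm_mul_inner_euler_add {ψ : E3 → C4} (hψ : ContDiff ℝ 2 ψ)
    (hc : HasCompactSupport ψ) :
    ∫ x, ‖x‖⁻¹ * inner ℝ (fderiv ℝ ψ x x + ψ x) (ψ x + spinOrbit ψ x) = 0 := by
  have hK : Continuous fun x => ψ x + spinOrbit ψ x :=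
    hψ.continuous.add (contDiff_spinOrbit hψ).continuous
  have hQ : Continuous fun x => inner ℝ (ψ x) (ψ x + spinOrbit ψ x) := hψ.continuous.inner hK
  have hcQ : HasCompactSupport fun x => inner ℝ (ψ x) (ψ x + spinOrbit ψ x) :=
    hc.mono fun x hx h => hx (by simp [h])
  have hh : Continuous fun x => inner ℝ (fderiv ℝ ψ x x + ψ x) (ψ x + spinOrbit ψ x) :=
    ((contDiff_euler hψ).continuous.add hψ.continuous).inner hK
  have hch : HasCompactSupport
      fun x => inner ℝ (fderiv ℝ ψ x x + ψ x) (ψ x + spinOrbit ψ x) := by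
    refine ((hc.fderiv ℝ).mono (f' := fun x => fderiv ℝ ψ x x) fun x hx h => hx (by simp [h])).add
      hc |>.mono fun x hx h => hx ?_
    rw [Function.mem_support, Pi.add_apply] at *
    simp [h]
  have h1 := (tendsto_integral_mul_of_regInv hh hch (w := regInv) (l := fun x => ‖x‖⁻¹)
    (fun δ hδ => (contDiff_regInv hδ).continuous)
    (fun δ hδ x => (abs_of_nonneg (regInv_nonneg (le_of_lt hδ) x)).le)
    fun x hx => tendsto_regInv hx).const_mul 2
  have h2 := (tendsto_integral_mul_of_regInv hQ hcQ
    (w := fun δ x => δ * (‖x‖ ^ 2 + δ)⁻¹ * regInv δ x) (l := fun _ => 0) (fun δ hδ => ?_)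
    (fun δ hδ x => ?_) fun x hx => ?_).neg
  · have heq : (fun δ => 2 * ∫ x, regInv δ x *
        inner ℝ (fderiv ℝ ψ x x + ψ x) (ψ x + spinOrbit ψ x)) =ᶠ[nhdsWithin 0 (Set.Ioi 0)]
        fun δ => -∫ x, δ * (‖x‖ ^ 2 + δ)⁻¹ * regInv δ x *
          inner ℝ (ψ x) (ψ x + spinOrbit ψ x) := by
      filter_upwards [self_mem_nhdsWithin] with δ hδ
      rw [integral_mul_inner_euler_add hψ hc (contDiff_regInv hδ) fun j x => by
        rw [fderiv_regInv hδ, inner_rotField, zero_mul, neg_zero]]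
      simp only [regInv_add_fderiv hδ]
    have := tendsto_nhds_unique (h1.congr' heq) h2
    simpa using this
  · have hδ' : 0 < δ := hδ
    exact (continuous_const.mul (((continuous_norm.pow 2).add continuous_const).inv₀
      fun x => (by positivity : ‖x‖ ^ 2 + δ ≠ 0))).mul (contDiff_regInv hδ).continuous
  · have hδ' : 0 < δ := hδ
    have hr := regInv_nonneg hδ'.le x
    rw [abs_of_nonneg (by positivity)]
    refine mul_le_of_le_one_left hr ?_
    rw [← div_eq_mul_inv]
    exact div_le_one_of_le₀ (by nlinarith [sq_nonneg ‖x‖]) (by positivity)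
  · have h3 : Tendsto (fun δ : ℝ => δ * (‖x‖ ^ 2 + δ)⁻¹) (nhdsWithin 0 (Set.Ioi 0)) (nhds 0) := by
      have : ContinuousAt (fun δ : ℝ => δ * (‖x‖ ^ 2 + δ)⁻¹) 0 :=
        continuousAt_id.mul ((continuousAt_const.add continuousAt_id).inv₀ (by simp [hx]))
      simpa using this.tendsto.mono_left nhdsWithin_le_nhds
    simpa using h3.mul (tendsto_regInv hx)

theorem twoSL_eq_spinOrbit (ψ : E3 → C4) (x : E3) : twoSL ψ x = spinOrbit ψ x := by
  simp only [twoSL, spinOrbit, angMom, mulVecE_smul, ← spinGen_apply, rotField_apply, map_sub,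
    map_smul, pderiv3]

theorem sum_smul_pderiv3 (ψ : E3 → C4) (x : E3) : ∑ j, x j • pderiv3 j ψ x = fderiv ℝ ψ x x := by
  simpa [pderiv3] using (congrArg (fderiv ℝ ψ x) (euclidean_eq_sum_single x)).symm

theorem radialDeriv_eq (ψ : E3 → C4) (x : E3) :
    radialDeriv ψ x = ‖x‖⁻¹ • fderiv ℝ ψ x x := by
  simp only [radialDeriv, ← sum_smul_pderiv3, Finset.smul_sum, smul_smul, div_eq_inv_mul]

theorem norm_sq_mul_norm_diracD_sq (ψ : E3 → C4) (x : E3) :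
    ‖x‖ ^ 2 * ‖diracD ψ x‖ ^ 2 = ‖fderiv ℝ ψ x x - spinOrbit ψ x‖ ^ 2 := by
  have h : ∑ j, spinGen j (x (j + 1) • pderiv3 (j + 2) ψ x - x (j + 2) • pderiv3 (j + 1) ψ x) =
      spinOrbit ψ x := by
    simp only [spinOrbit, rotField_apply, map_sub, map_smul, pderiv3]
  rw [diracD, norm_smul, norm_neg, Complex.norm_I, one_mul, ← norm_sq_diracAlpha_sum,
    diracAlpha_sum_mul, sum_smul_pderiv3, h]

theorem norm_mul_norm_diracD_sq (ψ : E3 → C4) {x : E3} (hx : x ≠ 0) :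
    ‖x‖ * ‖diracD ψ x‖ ^ 2 = ‖x‖ * ‖radialDeriv ψ x + ‖x‖⁻¹ • ψ x‖ ^ 2 +
      ‖ψ x + twoSL ψ x‖ ^ 2 / ‖x‖ -
      2 * (‖x‖⁻¹ * inner ℝ (fderiv ℝ ψ x x + ψ x) (ψ x + spinOrbit ψ x)) := by
  have hx' : ‖x‖ ≠ 0 := norm_ne_zero_iff.2 hx
  have h1 := norm_sq_mul_norm_diracD_sq ψ x
  rw [show fderiv ℝ ψ x x - spinOrbit ψ x = (fderiv ℝ ψ x x + ψ x) - (ψ x + spinOrbit ψ x) by abel,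
    norm_sub_sq_real] at h1
  rw [twoSL_eq_spinOrbit, radialDeriv_eq, ← smul_add, norm_smul, norm_inv, norm_norm]
  field_simp
  linear_combination h1

/-- splitting of the weighted Dirac energy. -/
theorem weighted_dirac_energy_split (ψ : E3 → C4) (hsmooth : ContDiff ℝ (⊤ : ℕ∞) ψ)
    (hsupp : HasCompactSupport ψ) :
    (∫ x : E3, ‖x‖ * ‖diracD ψ x‖ ^ 2) =
      (∫ x : E3, ‖x‖ * ‖radialDeriv ψ x + ‖x‖⁻¹ • ψ x‖ ^ 2) +
        ∫ x : E3, ‖ψ x + twoSL ψ x‖ ^ 2 / ‖x‖ := by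
  have hψ : ContDiff ℝ 2 ψ := mod_cast contDiff_infty.1 hsmooth 2
  have hE : Continuous fun x => fderiv ℝ ψ x x := (contDiff_euler hψ).continuous
  have hT : Continuous (spinOrbit ψ) := (contDiff_spinOrbit hψ).continuous
  have hcE : HasCompactSupport fun x => fderiv ℝ ψ x x :=
    (hsupp.fderiv ℝ).mono fun x hx h => hx (by simp [h])
  have hcT : HasCompactSupport (spinOrbit ψ) :=
    (hsupp.fderiv ℝ).mono fun x hx h => hx (by simp [spinOrbit, h])
  have hcEψ : HasCompactSupport fun x => fderiv ℝ ψ x x + ψ x := hcE.add hsupp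
  have hcK : HasCompactSupport fun x => ψ x + spinOrbit ψ x := hsupp.add hcT
  have hne : ∀ᵐ x : E3, x ≠ 0 := by simp [ae_iff]
  have hA : Integrable fun x : E3 => ‖x‖ * ‖radialDeriv ψ x + ‖x‖⁻¹ • ψ x‖ ^ 2 := by
    refine (integrable_inv_norm_mul ((hE.add hψ.continuous).norm.pow 2)
      (hcEψ.mono fun x hx h => hx (by simp_all))).congr ?_
    filter_upwards [hne] with x hx
    have hx' : ‖x‖ ≠ 0 := norm_ne_zero_iff.2 hx
    rw [radialDeriv_eq, ← smul_add, norm_smul, norm_inv, norm_norm]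
    field_simp
    rfl
  have hB : Integrable fun x : E3 => ‖ψ x + twoSL ψ x‖ ^ 2 / ‖x‖ := by
    simp only [twoSL_eq_spinOrbit, div_eq_inv_mul]
    exact integrable_inv_norm_mul ((hψ.continuous.add hT).norm.pow 2)
      (hcK.mono fun x hx h => hx (by simp_all))
  have hAB : Integrable fun x : E3 =>
      ‖x‖⁻¹ * inner ℝ (fderiv ℝ ψ x x + ψ x) (ψ x + spinOrbit ψ x) :=
    integrable_inv_norm_mul ((hE.add hψ.continuous).inner (hψ.continuous.add hT))
      (hcEψ.mono fun x hx h => hx (by simp_all))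
  rw [integral_congr_ae (hne.mono fun x hx => norm_mul_norm_diracD_sq ψ hx),
    integral_sub (by exact hA.add hB) (hAB.const_mul 2), integral_add hA hB, integral_const_mul,
    integral_inv_norm_mul_inner_euler_add hψ hsupp, mul_zero, sub_zero]
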